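/- arXiv:0807.0115 — 3 statements merged into one kernel-verified Lean document; each statement's English description precedes it below -/
import Mathlib

section
/- Let x ∈ Σ. If limsup_{n→∞} S_nχ(x) > −∞ (equivalently, limsup_{n→∞} e^{S_nχ(x)} > 0), then limsup_{n→∞} S_nφ(x)/S_nψ(x) ≥ 1. -/
open Set Filter Topology

noncomputable section

/-- The shift map on `Σ = {1,…,d}^ℕ` (`x n` represents the letter `x_{n+1}`). -/
def shift {d : ℕ} (x : ℕ → Fin d) : ℕ → Fin d := fun n => x (n + 1)

/-- The cylinder set `[x_1 … x_n]`. -/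
def cyl {d : ℕ} (x : ℕ → Fin d) (n : ℕ) : Set (ℕ → Fin d) := {y | ∀ m < n, y m = x m}

/-- Birkhoff sums `S_n f(x) = ∑_{m=0}^{n-1} f(σ^m x)`. -/
def birk {d : ℕ} (f : (ℕ → Fin d) → ℝ) (n : ℕ) (x : ℕ → Fin d) : ℝ :=
  ∑ m ∈ Finset.range n, f (shift^[m] x)

/-- The Birkhoff sums of a negative continuous function decay at least linearly, uniformly
in the base point. -/
theorem exists_birk_le_neg_mul {d : ℕ} (f : (ℕ → Fin d) → ℝ) (hfc : Continuous f)
    (hf : ∀ x, f x < 0) : ∃ c > 0, ∀ n x, birk f n x ≤ -(n * c) := by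
  obtain ⟨c, hc, hfc'⟩ : ∃ c > 0, ∀ x, f x ≤ -c := by
    rcases isEmpty_or_nonempty (ℕ → Fin d) with _ | _
    · exact ⟨1, one_pos, isEmptyElim⟩
    · obtain ⟨y, -, hy⟩ := isCompact_univ.exists_isMaxOn univ_nonempty hfc.continuousOn
      exact ⟨-f y, neg_pos.mpr (hf y), fun x => by simpa using hy (mem_univ x)⟩
  refine ⟨c, hc, fun n x => ?_⟩
  calc birk f n x ≤ ∑ _m ∈ Finset.range n, -c := Finset.sum_le_sum fun m _ => hfc' _
    _ = -(n * c) := by simp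

theorem birk_sub {d : ℕ} (f g : (ℕ → Fin d) → ℝ) (n : ℕ) (x : ℕ → Fin d) :
    birk (fun z => f z - g z) n x = birk f n x - birk g n x :=
  Finset.sum_sub_distrib _ _

/-- Let `φ, ψ : Σ → (-∞,0)` be continuous and `χ := ψ - φ`.  If
`limsup_n S_nχ(x) > -∞` (i.e. the Birkhoff sums of `χ` are bounded below along a
subsequence), then `limsup_n S_nφ(x)/S_nψ(x) ≥ 1`. -/
theorem statement_8 {d : ℕ} (hd : 2 ≤ d)
    (φ ψ : (ℕ → Fin d) → ℝ) (hφc : Continuous φ) (hψc : Continuous ψ)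
    (hφ : ∀ x, φ x < 0) (hψ : ∀ x, ψ x < 0)
    (x : ℕ → Fin d)
    (h : ∃ M : ℝ, ∀ N : ℕ, ∃ n ≥ N, M ≤ birk (fun z => ψ z - φ z) n x) :
    ∀ e > 0, ∀ N : ℕ, ∃ n ≥ N, 1 - e < birk φ n x / birk ψ n x := by
  intro e he N
  obtain ⟨M, hM⟩ := h
  obtain ⟨c, hc, hbirk⟩ := exists_birk_le_neg_mul ψ hψc hψ
  obtain ⟨K, hK⟩ := exists_nat_gt (max 0 (-M / (e * c)))
  obtain ⟨n, hn, hMn⟩ := hM (max N K)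
  refine ⟨n, (le_max_left _ _).trans hn, ?_⟩
  have hKn : (K : ℝ) ≤ n := by exact_mod_cast (le_max_right _ _).trans hn
  have hn0 : (0 : ℝ) < n := ((le_max_left _ _).trans_lt hK).trans_le hKn
  have hMe : -M < n * (e * c) :=
    (div_lt_iff₀ (by positivity)).mp (((le_max_right _ _).trans_lt hK).trans_le hKn)
  have hψn := hbirk n x
  have hneg : birk ψ n x < 0 := hψn.trans_lt (neg_lt_zero.mpr (mul_pos hn0 hc))
  rw [birk_sub] at hMn
  rw [lt_div_iff_of_neg hneg]
  nlinarith [mul_le_mul_of_nonneg_left hψn he.le]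
end
end

section
/- For μ-almost every x ∈ Σ one has limsup_{n→∞} k_n(x)/log n ≤ κ, where κ := max{−1/f(1̄), −1/f(d̄)}. -/
open Set Filter Topology

noncomputable section

open MeasureTheory

/-- The sequence that starts with the word `w` and continues with the letter `i` forever. -/
def wordThen {d n : ℕ} (i : Fin d) (w : Fin n → Fin d) : ℕ → Fin d :=
  fun m => if h : m < n then w ⟨m, h⟩ else i

lemma shift_iterate_apply {d : ℕ} (x : ℕ → Fin d) (m j : ℕ) : shift^[m] x j = x (j + m) := by
  induction m generalizing x j with
  | zero => rfl
  | succ m ih =>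
    rw [Function.iterate_succ_apply, ih]
    exact congrArg x (by omega)

lemma measurableSet_cyl {d : ℕ} (x : ℕ → Fin d) (n : ℕ) : MeasurableSet (cyl x n) := by
  simp only [cyl, ofPred_forall]
  exact MeasurableSet.iInter fun m => MeasurableSet.iInter fun _ =>
    measurableSet_eq_fun (measurable_pi_apply m) measurable_const

lemma birk_wordThen_add {d n : ℕ} (f : (ℕ → Fin d) → ℝ) (i : Fin d) (w : Fin n → Fin d)
    (k : ℕ) :
    birk f (n + k) (wordThen i w) = birk f n (wordThen i w) + k * f (fun _ => i) := by
  have h : ∀ j, shift^[n + j] (wordThen i w) = fun _ => i := by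
    intro j
    ext1 m
    rw [shift_iterate_apply, wordThen, dif_neg (by omega)]
  simp [birk, Finset.sum_range_add, h]

lemma pairwise_disjoint_cyl_wordThen {d n : ℕ} (i : Fin d) :
    Pairwise (Function.onFun Disjoint fun w : Fin n → Fin d => cyl (wordThen i w) n) := by
  intro v w hvw
  refine Set.disjoint_left.2 fun x hv hw => hvw ?_
  ext1 m
  have h := (hv m m.2).symm.trans (hw m m.2)
  simpa [wordThen] using h

/-- For a Gibbs measure, the probability that a block of `k` letters `i` begins at place `n` is
at most a constant times `exp (k f(ī))`, uniformly in `n`. -/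
lemma measure_run_le {d : ℕ} (f : (ℕ → Fin d) → ℝ) (μ : Measure (ℕ → Fin d))
    [IsProbabilityMeasure μ] {C : ℝ} (hC : 1 ≤ C)
    (hG : ∀ x : ℕ → Fin d, ∀ n : ℕ,
      ENNReal.ofReal (C⁻¹ * Real.exp (birk f n x)) ≤ μ (cyl x n) ∧
        μ (cyl x n) ≤ ENNReal.ofReal (C * Real.exp (birk f n x)))
    (i : Fin d) (n k : ℕ) :
    μ {x | ∀ m < k, x (n + m) = i} ≤ ENNReal.ofReal (C ^ 2 * Real.exp (k * f fun _ => i)) := by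
  have hC0 : 0 < C := by linarith
  have hsub : {x : ℕ → Fin d | ∀ m < k, x (n + m) = i} ⊆
      ⋃ w : Fin n → Fin d, cyl (wordThen i w) (n + k) := by
    intro x hx
    refine mem_iUnion.2 ⟨fun m => x m, fun m hm => ?_⟩
    by_cases h : m < n
    · simp [wordThen, h]
    · obtain ⟨j, rfl⟩ := Nat.exists_eq_add_of_le (not_lt.1 h)
      simp [wordThen, hx j (by omega)]
  have hword : ∀ w : Fin n → Fin d, μ (cyl (wordThen i w) (n + k)) ≤
      ENNReal.ofReal (C ^ 2 * Real.exp (k * f fun _ => i)) * μ (cyl (wordThen i w) n) := by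
    intro w
    calc μ (cyl (wordThen i w) (n + k))
        ≤ ENNReal.ofReal (C * Real.exp (birk f (n + k) (wordThen i w))) := (hG _ _).2
      _ = ENNReal.ofReal (C ^ 2 * Real.exp (k * f fun _ => i)) *
            ENNReal.ofReal (C⁻¹ * Real.exp (birk f n (wordThen i w))) := by
          rw [← ENNReal.ofReal_mul (by positivity), birk_wordThen_add, Real.exp_add]
          congr 1
          field_simp
      _ ≤ _ := by gcongr; exact (hG _ _).1
  calc μ {x | ∀ m < k, x (n + m) = i}
      ≤ ∑ w : Fin n → Fin d, μ (cyl (wordThen i w) (n + k)) :=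
        (measure_mono hsub).trans (measure_iUnion_fintype_le _ _)
    _ ≤ ∑ w : Fin n → Fin d,
          ENNReal.ofReal (C ^ 2 * Real.exp (k * f fun _ => i)) * μ (cyl (wordThen i w) n) :=
        Finset.sum_le_sum fun w _ => hword w
    _ ≤ ENNReal.ofReal (C ^ 2 * Real.exp (k * f fun _ => i)) * 1 := by
        rw [← Finset.mul_sum]
        gcongr
        rw [← tsum_fintype (L := .unconditional _), ← measure_iUnion
          (pairwise_disjoint_cyl_wordThen i) fun w => measurableSet_cyl _ _]
        exact prob_le_one
    _ = _ := mul_one _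

/-- Borel–Cantelli bound on the lengths of blocks of a letter `i` with `f(ī) < 0`, for a fixed
rate `c`. -/
lemma ae_eventually_run_le {d : ℕ} (f : (ℕ → Fin d) → ℝ) (μ : Measure (ℕ → Fin d))
    [IsProbabilityMeasure μ] {C : ℝ} (hC : 1 ≤ C)
    (hG : ∀ x : ℕ → Fin d, ∀ n : ℕ,
      ENNReal.ofReal (C⁻¹ * Real.exp (birk f n x)) ≤ μ (cyl x n) ∧
        μ (cyl x n) ≤ ENNReal.ofReal (C * Real.exp (birk f n x)))
    (i : Fin d) (hi : f (fun _ => i) < 0) {c : ℝ} (hc : -1 / f (fun _ => i) < c) :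
    ∀ᵐ x ∂μ, ∀ᶠ n : ℕ in atTop, ∀ k : ℕ,
      (∀ m < k, x (n + m) = i) → (k : ℝ) ≤ c * Real.log n := by
  set l := f fun _ => i
  have hcl : c * l < -1 := (div_lt_iff_of_neg hi).1 hc
  let K : ℕ → ℕ := fun n => ⌊c * Real.log n⌋₊ + 1
  have hbound : ∀ n : ℕ, μ {x | ∀ m < K (n + 1), x (n + 1 + m) = i} ≤
      ENNReal.ofReal (C ^ 2 * ((n + 1 : ℕ) : ℝ) ^ (c * l)) := by
    intro n
    refine (measure_run_le f μ hC hG i (n + 1) _).trans (ENNReal.ofReal_le_ofReal ?_)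
    rw [Real.rpow_def_of_pos (by positivity)]
    have hK : c * Real.log (n + 1 : ℕ) ≤ K (n + 1) := by
      simpa [K] using (Nat.lt_floor_add_one (c * Real.log (n + 1 : ℕ))).le
    refine mul_le_mul_of_nonneg_left (Real.exp_le_exp.2 ?_) (by positivity)
    calc (K (n + 1) : ℝ) * l ≤ c * Real.log (n + 1 : ℕ) * l :=
          mul_le_mul_of_nonpos_right hK hi.le
      _ = Real.log (n + 1 : ℕ) * (c * l) := by ring
  have hsum : Summable fun n : ℕ => C ^ 2 * ((n + 1 : ℕ) : ℝ) ^ (c * l) :=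
    ((summable_nat_add_iff 1).2 (Real.summable_nat_rpow.2 hcl)).mul_left _
  have hfin : ∑' n : ℕ, μ {x | ∀ m < K (n + 1), x (n + 1 + m) = i} ≠ ⊤ :=
    ne_top_of_le_ne_top hsum.tsum_ofReal_ne_top (ENNReal.tsum_le_tsum hbound)
  filter_upwards [ae_eventually_notMem hfin] with x hx
  rw [← map_add_atTop_eq_nat 1, eventually_map]
  filter_upwards [hx] with n hn k hk
  by_contra! hlt
  refine hn fun m hm => hk m (hm.trans_le ?_)
  have hpos : 0 ≤ c * Real.log (n + 1 : ℕ) :=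
    mul_nonneg ((div_pos_of_neg_of_neg (by norm_num) hi).trans hc).le (Real.log_natCast_nonneg _)
  exact Nat.succ_le_of_lt ((Nat.floor_lt hpos).2 hlt)

/-- The Borel–Cantelli bound on the lengths of blocks of `i`, simultaneously for all rates. -/
lemma ae_forall_eventually_run_le {d : ℕ} (f : (ℕ → Fin d) → ℝ) (μ : Measure (ℕ → Fin d))
    [IsProbabilityMeasure μ] {C : ℝ} (hC : 1 ≤ C)
    (hG : ∀ x : ℕ → Fin d, ∀ n : ℕ,
      ENNReal.ofReal (C⁻¹ * Real.exp (birk f n x)) ≤ μ (cyl x n) ∧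
        μ (cyl x n) ≤ ENNReal.ofReal (C * Real.exp (birk f n x)))
    (i : Fin d) (hi : f (fun _ => i) < 0) :
    ∀ᵐ x ∂μ, ∀ c : ℝ, -1 / f (fun _ => i) < c → ∀ᶠ n : ℕ in atTop, ∀ k : ℕ,
      (∀ m < k, x (n + m) = i) → (k : ℝ) ≤ c * Real.log n := by
  have hrat : ∀ᵐ x ∂μ, ∀ q : ℚ, -1 / f (fun _ => i) < q → ∀ᶠ n : ℕ in atTop, ∀ k : ℕ,
      (∀ m < k, x (n + m) = i) → (k : ℝ) ≤ q * Real.log n :=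
    ae_all_iff.2 fun q => by
      by_cases hq : -1 / f (fun _ => i) < q
      · filter_upwards [ae_eventually_run_le f μ hC hG i hi hq] with x hx _ using hx
      · exact ae_of_all _ fun _ h => absurd h hq
  filter_upwards [hrat] with x hx c hc
  obtain ⟨q, hq, hqc⟩ := exists_rat_btwn hc
  filter_upwards [hx q hq] with n hn k hk
  exact (hn k hk).trans (mul_le_mul_of_nonneg_right hqc.le (Real.log_natCast_nonneg n))

/-- Lemma `Khint`.  Let `f : Σ → ℝ` be Hölder continuous with
`f(1̄) < 0`, `f(d̄) < 0`, and let `μ` have the Gibbs property for `f`.  With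
`κ := max{-1/f(1̄), -1/f(d̄)}`, for `μ`-a.e. `x` one has
`limsup_n k_n(x)/log n ≤ κ`, where `k_n(x)` is the length of the `i`-block
(`i ∈ {1,d}`) of `x` at the `n`-th level (and `0` if `x_{n+1} ∉ {1,d}`). -/
theorem statement_10 {d : ℕ} (hd : 2 ≤ d)
    (f : (ℕ → Fin d) → ℝ)
    (hfH : ∃ C > 0, ∃ r ∈ Set.Ioo (0 : ℝ) 1, ∀ x y : ℕ → Fin d, ∀ n : ℕ,
      (∀ m < n, x m = y m) → |f x - f y| ≤ C * r ^ n)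
    (hf1 : f (fun _ => (⟨0, by omega⟩ : Fin d)) < 0)
    (hfd : f (fun _ => (⟨d - 1, by omega⟩ : Fin d)) < 0)
    (μ : MeasureTheory.Measure (ℕ → Fin d)) [MeasureTheory.IsProbabilityMeasure μ]
    (hGibbs : ∃ C : ℝ, 1 ≤ C ∧ ∀ x : ℕ → Fin d, ∀ n : ℕ,
      ENNReal.ofReal (C⁻¹ * Real.exp (birk f n x)) ≤ μ (cyl x n) ∧
        μ (cyl x n) ≤ ENNReal.ofReal (C * Real.exp (birk f n x))) :
    ∀ᵐ x ∂μ, ∀ c : ℝ,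
      max (-1 / f (fun _ => (⟨0, by omega⟩ : Fin d)))
          (-1 / f (fun _ => (⟨d - 1, by omega⟩ : Fin d))) < c →
      ∀ᶠ n : ℕ in Filter.atTop, ∀ k : ℕ, ∀ i : Fin d,
        (i = (⟨0, by omega⟩ : Fin d) ∨ i = (⟨d - 1, by omega⟩ : Fin d)) →
        (∀ m < k, x (n + m) = i) → x (n + k) ≠ i →
        (k : ℝ) ≤ c * Real.log (n : ℝ) := by
  obtain ⟨C, hC, hG⟩ := hGibbs
  filter_upwards [ae_forall_eventually_run_le f μ hC hG _ hf1,
    ae_forall_eventually_run_le f μ hC hG _ hfd] with x h1 h2 c hc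
  filter_upwards [h1 c ((le_max_left _ _).trans_lt hc), h2 c ((le_max_right _ _).trans_lt hc)]
    with n hn1 hn2 k i hi hk _
  rcases hi with rfl | rfl
  · exact hn1 k hk
  · exact hn2 k hk
end
end

section
/- Suppose there exists a bounded function v : Σ → ℝ with χ = v − v∘σ on Σ. Then the conjugacy Θ is bi-Lipschitz: there exists c ≥ 1 such that c^{-1}|ξ−η| ≤ |Θ(ξ)−Θ(η)| ≤ c|ξ−η| for all ξ, η ∈ 𝒰. -/
open Set Filter Topology

noncomputable section

/-- The unit interval `𝒰 = [0,1]`. -/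
abbrev UI : Set ℝ := Set.Icc 0 1

/-- An expanding piecewise `C^{1+ε}` map of the unit interval, presented through its
`d` increasing full inverse branches (ordered left to right, images covering `𝒰` with
pairwise disjoint interiors), each branch being a `C^{1+ε}` diffeomorphism onto its image
whose derivative is `ε`-Hölder continuous with values in `(0,1)`. -/
structure ExpMap (d : ℕ) (ε : ℝ) : Type where
  toFun : ℝ → ℝ
  branch : Fin d → ℝ → ℝ
  branchDeriv : Fin d → ℝ → ℝ
  maps_to : Set.MapsTo toFun UI UI
  branch_maps_to : ∀ a, Set.MapsTo (branch a) UI UI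
  branch_mono : ∀ a, StrictMonoOn (branch a) UI
  right_inv : ∀ a, ∀ ξ ∈ Set.Ico (0 : ℝ) 1, toFun (branch a ξ) = ξ
  map_one : toFun 1 = 1
  branch_hasDeriv : ∀ a, ∀ ξ ∈ UI, HasDerivWithinAt (branch a) (branchDeriv a ξ) UI ξ
  branchDeriv_mem : ∀ a, ∀ ξ ∈ UI, branchDeriv a ξ ∈ Set.Ioo (0 : ℝ) 1
  branchDeriv_holder : ∀ a, ∃ C > 0, ∀ ξ ∈ UI, ∀ η ∈ UI,
      |branchDeriv a ξ - branchDeriv a η| ≤ C * |ξ - η| ^ ε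
  ordered : ∀ a b : Fin d, a < b → ∀ ξ ∈ UI, ∀ η ∈ UI, branch a ξ ≤ branch b η
  cover : UI ⊆ ⋃ a, branch a '' UI

/-- Finite approximations `S_{x_1}^{-1} ∘ ⋯ ∘ S_{x_n}^{-1}(0)` to the coding map. -/
def approx {d : ℕ} {ε : ℝ} (S : ExpMap d ε) (x : ℕ → Fin d) (n : ℕ) : ℝ :=
  (List.range n).foldr (fun m ξ => S.branch (x m) ξ) 0

/-- The coding map `π_S : Σ → 𝒰`. -/
def proj {d : ℕ} {ε : ℝ} (S : ExpMap d ε) (x : ℕ → Fin d) : ℝ := ⨆ n, approx S x n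

/-- The potential `φ(x) = log (S_{x_1}^{-1})'(π_S(σ x))` associated with `S`. -/
def pot {d : ℕ} {ε : ℝ} (S : ExpMap d ε) (x : ℕ → Fin d) : ℝ :=
  Real.log (S.branchDeriv (x 0) (proj S (shift x)))

/-- The difference quotient `D_Θ(ξ, η) = (Θ(ξ) - Θ(η))/(ξ - η)`. -/
def DQ (Θ : ℝ → ℝ) (ξ η : ℝ) : ℝ := (Θ ξ - Θ η) / (ξ - η)

/-- `Θ` is the conjugacy between `S` and `T` : an increasing homeomorphism of `𝒰`
with `T ∘ Θ = Θ ∘ S`. -/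
def IsConjugacy {d : ℕ} {ε : ℝ} (S T : ExpMap d ε) (Θ : ℝ → ℝ) : Prop :=
  StrictMonoOn Θ UI ∧ ContinuousOn Θ UI ∧ Θ '' UI = UI ∧
    ∀ ξ ∈ UI, T.toFun (Θ ξ) = Θ (S.toFun ξ)

/-- `x` has an `i`-block of length `k` at the `n`-th level:
`x_{n+1} = ⋯ = x_{n+k} = i` and `x_{n+k+1} ≠ i`. -/
def HasBlock {d : ℕ} (x : ℕ → Fin d) (i : Fin d) (k n : ℕ) : Prop :=
  (∀ m < k, x (n + m) = i) ∧ x (n + k) ≠ i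

/-- `x` is eventually constant. -/
def EvConst {d : ℕ} (x : ℕ → Fin d) : Prop := ∃ N : ℕ, ∃ i : Fin d, ∀ n ≥ N, x n = i

/-- `Θ'(ξ)` exists in the generalised sense: `lim_{η→ξ} D_Θ(ξ,η)` exists in `[0,∞]`
(with one-sided limits at the boundary points). -/
def GenDeriv (Θ : ℝ → ℝ) (ξ : ℝ) : Prop :=
  (∃ L : ℝ, Filter.Tendsto (fun η => DQ Θ ξ η) (nhdsWithin ξ (UI \ {ξ})) (nhds L)) ∨
    Filter.Tendsto (fun η => DQ Θ ξ η) (nhdsWithin ξ (UI \ {ξ})) Filter.atTop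

namespace ExpMap

variable {d : ℕ} {ε : ℝ}

theorem zero_mem_UI : (0 : ℝ) ∈ UI := ⟨le_rfl, zero_le_one⟩

theorem one_mem_UI : (1 : ℝ) ∈ UI := ⟨zero_le_one, le_rfl⟩

theorem continuousOn_branch (S : ExpMap d ε) (a : Fin d) : ContinuousOn (S.branch a) UI :=
  fun ξ hξ => (S.branch_hasDeriv a ξ hξ).continuousWithinAt

theorem continuousOn_branchDeriv (S : ExpMap d ε) (hε : 0 < ε) (a : Fin d) :
    ContinuousOn (S.branchDeriv a) UI := by
  obtain ⟨C, -, hC⟩ := S.branchDeriv_holder a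
  intro ξ hξ
  have hcont : Continuous fun η : ℝ => C * |η - ξ| ^ ε :=
    continuous_const.mul
      (((continuous_id.sub continuous_const).abs).rpow_const fun _ => Or.inr hε.le)
  have hlim : Tendsto (fun η : ℝ => C * |η - ξ| ^ ε) (𝓝[UI] ξ) (𝓝 0) := by
    have h := (hcont.tendsto ξ).mono_left (nhdsWithin_le_nhds (s := UI))
    simpa [Real.zero_rpow hε.ne'] using h
  refine tendsto_iff_dist_tendsto_zero.2 (squeeze_zero' (.of_forall fun _ => dist_nonneg) ?_ hlim)
  filter_upwards [self_mem_nhdsWithin] with η hη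
  exact hC η hη ξ hξ

/-- The branch derivatives are uniformly bounded away from `1`. -/
theorem exists_branchDeriv_le (S : ExpMap d ε) (hε : 0 < ε) (hd : 0 < d) :
    ∃ κ : ℝ, 0 < κ ∧ κ < 1 ∧ ∀ a, ∀ ξ ∈ UI, S.branchDeriv a ξ ≤ κ := by
  have : Nonempty (Fin d) := ⟨⟨0, hd⟩⟩
  have hmax : ∀ a, ∃ m ∈ UI, ∀ ξ ∈ UI, S.branchDeriv a ξ ≤ S.branchDeriv a m := fun a =>
    isCompact_Icc.exists_isMaxOn ⟨0, zero_mem_UI⟩ (S.continuousOn_branchDeriv hε a)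
  choose m hm hle using hmax
  obtain ⟨b, hb⟩ := Finite.exists_max fun a => S.branchDeriv a (m a)
  exact ⟨S.branchDeriv b (m b), (S.branchDeriv_mem b _ (hm b)).1, (S.branchDeriv_mem b _ (hm b)).2,
    fun a ξ hξ => (hle a ξ hξ).trans (hb a)⟩

theorem abs_log_sub_log_le {δ a b : ℝ} (hδ : 0 < δ) (ha : δ ≤ a) (hb : δ ≤ b) :
    |Real.log a - Real.log b| ≤ |a - b| / δ := by
  have key : ∀ s t : ℝ, δ ≤ s → δ ≤ t → Real.log s - Real.log t ≤ |s - t| / δ := by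
    intro s t hs ht
    have hs' := hδ.trans_le hs
    have ht' := hδ.trans_le ht
    rw [← Real.log_div hs'.ne' ht'.ne']
    calc Real.log (s / t) ≤ s / t - 1 := Real.log_le_sub_one_of_pos (div_pos hs' ht')
      _ = (s - t) / t := by field_simp
      _ ≤ |s - t| / t := by gcongr; exact le_abs_self _
      _ ≤ |s - t| / δ := by gcongr
  refine abs_sub_le_iff.2 ⟨key a b ha hb, ?_⟩
  rw [abs_sub_comm]
  exact key b a hb ha

/-- The logarithms of the branch derivatives are uniformly Hölder continuous. -/
theorem exists_log_branchDeriv_holder (S : ExpMap d ε) (hε : 0 < ε) (hd : 0 < d) :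
    ∃ C : ℝ, 0 ≤ C ∧ ∀ a, ∀ ξ ∈ UI, ∀ η ∈ UI,
      |Real.log (S.branchDeriv a ξ) - Real.log (S.branchDeriv a η)| ≤ C * |ξ - η| ^ ε := by
  have : Nonempty (Fin d) := ⟨⟨0, hd⟩⟩
  have hloc : ∀ a, ∃ C : ℝ, 0 ≤ C ∧ ∀ ξ ∈ UI, ∀ η ∈ UI,
      |Real.log (S.branchDeriv a ξ) - Real.log (S.branchDeriv a η)| ≤ C * |ξ - η| ^ ε := by
    intro a
    obtain ⟨m, hm, hle⟩ :=
      isCompact_Icc.exists_isMinOn ⟨0, zero_mem_UI⟩ (S.continuousOn_branchDeriv hε a)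
    obtain ⟨C, hC, hhol⟩ := S.branchDeriv_holder a
    have hδ := (S.branchDeriv_mem a m hm).1
    refine ⟨C / S.branchDeriv a m, (div_pos hC hδ).le, fun ξ hξ η hη => ?_⟩
    refine (abs_log_sub_log_le hδ (hle hξ) (hle hη)).trans ?_
    rw [div_mul_eq_mul_div]
    gcongr
    exact hhol ξ hξ η hη
  choose C hC hhol using hloc
  obtain ⟨b, hb⟩ := Finite.exists_max C
  refine ⟨C b, hC b, fun a ξ hξ η hη => (hhol a ξ hξ η hη).trans ?_⟩
  gcongr
  exact hb a

theorem abs_branch_sub_le (S : ExpMap d ε) {κ : ℝ}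
    (hκ : ∀ a, ∀ ξ ∈ UI, S.branchDeriv a ξ ≤ κ) (a : Fin d) {ξ η : ℝ} (hξ : ξ ∈ UI)
    (hη : η ∈ UI) : |S.branch a ξ - S.branch a η| ≤ κ * |ξ - η| := by
  refine (convex_Icc (0 : ℝ) 1).norm_image_sub_le_of_norm_hasDerivWithin_le
    (fun z hz => S.branch_hasDeriv a z hz) (fun z hz => ?_) hη hξ
  rw [Real.norm_of_nonneg (S.branchDeriv_mem a z hz).1.le]
  exact hκ a z hz

/-- The composition `S_{x_1}^{-1} ∘ ⋯ ∘ S_{x_n}^{-1}`. -/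
def comp (S : ExpMap d ε) : ℕ → (ℕ → Fin d) → ℝ → ℝ
  | 0, _, ξ => ξ
  | n + 1, x, ξ => S.branch (x 0) (comp S n (shift x) ξ)

/-- The derivative of `S_{x_1}^{-1} ∘ ⋯ ∘ S_{x_n}^{-1}`. -/
def compDeriv (S : ExpMap d ε) : ℕ → (ℕ → Fin d) → ℝ → ℝ
  | 0, _, _ => 1
  | n + 1, x, ξ => S.branchDeriv (x 0) (S.comp n (shift x) ξ) * compDeriv S n (shift x) ξ

theorem comp_mem (S : ExpMap d ε) (n : ℕ) (x : ℕ → Fin d) : MapsTo (S.comp n x) UI UI := by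
  induction n generalizing x with
  | zero => exact fun ξ hξ => hξ
  | succ n ih => exact fun ξ hξ => S.branch_maps_to _ (ih _ hξ)

theorem comp_strictMonoOn (S : ExpMap d ε) (n : ℕ) (x : ℕ → Fin d) :
    StrictMonoOn (S.comp n x) UI := by
  induction n generalizing x with
  | zero => exact fun _ _ _ _ h => h
  | succ n ih =>
    exact fun ξ hξ η hη h =>
      S.branch_mono _ (S.comp_mem n _ hξ) (S.comp_mem n _ hη) (ih _ hξ hη h)

theorem comp_hasDerivWithinAt (S : ExpMap d ε) (n : ℕ) (x : ℕ → Fin d) {ξ : ℝ} (hξ : ξ ∈ UI) :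
    HasDerivWithinAt (S.comp n x) (S.compDeriv n x ξ) UI ξ := by
  induction n generalizing x with
  | zero => exact hasDerivWithinAt_id ξ UI
  | succ n ih =>
    exact (S.branch_hasDeriv (x 0) _ (S.comp_mem n _ hξ)).comp ξ (ih _) (S.comp_mem n _)

theorem compDeriv_pos (S : ExpMap d ε) (n : ℕ) (x : ℕ → Fin d) {ξ : ℝ} (hξ : ξ ∈ UI) :
    0 < S.compDeriv n x ξ := by
  induction n generalizing x with
  | zero => exact one_pos
  | succ n ih => exact mul_pos (S.branchDeriv_mem _ _ (S.comp_mem n _ hξ)).1 (ih _)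

theorem log_compDeriv_succ (S : ExpMap d ε) (n : ℕ) (x : ℕ → Fin d) {ξ : ℝ} (hξ : ξ ∈ UI) :
    Real.log (S.compDeriv (n + 1) x ξ) =
      Real.log (S.branchDeriv (x 0) (S.comp n (shift x) ξ)) +
        Real.log (S.compDeriv n (shift x) ξ) :=
  Real.log_mul (S.branchDeriv_mem _ _ (S.comp_mem n _ hξ)).1.ne' (S.compDeriv_pos n _ hξ).ne'

theorem exists_compDeriv_eq (S : ExpMap d ε) (n : ℕ) (x : ℕ → Fin d) :
    ∃ ζ ∈ UI, S.compDeriv n x ζ = S.comp n x 1 - S.comp n x 0 := by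
  obtain ⟨ζ, hζ, h⟩ := exists_hasDerivAt_eq_slope (S.comp n x) (S.compDeriv n x) zero_lt_one
    (fun ξ hξ => (S.comp_hasDerivWithinAt n x hξ).continuousWithinAt)
    (fun ξ hξ => (S.comp_hasDerivWithinAt n x (Ioo_subset_Icc_self hξ)).hasDerivAt
      (Icc_mem_nhds hξ.1 hξ.2))
  exact ⟨ζ, Ioo_subset_Icc_self hζ, by simpa using h⟩

theorem abs_comp_sub_le (S : ExpMap d ε) {κ : ℝ} (hκ0 : 0 ≤ κ)
    (hκ : ∀ a, ∀ ξ ∈ UI, S.branchDeriv a ξ ≤ κ) (n : ℕ) (x : ℕ → Fin d) {ξ η : ℝ}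
    (hξ : ξ ∈ UI) (hη : η ∈ UI) : |S.comp n x ξ - S.comp n x η| ≤ κ ^ n := by
  induction n generalizing x with
  | zero =>
    rw [pow_zero, abs_sub_le_iff]
    exact ⟨by simp only [comp]; linarith [hξ.2, hη.1], by simp only [comp]; linarith [hη.2, hξ.1]⟩
  | succ n ih =>
    refine (S.abs_branch_sub_le hκ _ (S.comp_mem n _ hξ) (S.comp_mem n _ hη)).trans ?_
    rw [pow_succ']
    exact mul_le_mul_of_nonneg_left (ih _) hκ0

/-- Bounded distortion. -/
theorem exists_distortion_bound (S : ExpMap d ε) (hε : 0 < ε) (hd : 0 < d) :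
    ∃ D : ℝ, 0 ≤ D ∧ ∀ n x, ∀ ξ ∈ UI, ∀ η ∈ UI,
      |Real.log (S.compDeriv n x ξ) - Real.log (S.compDeriv n x η)| ≤ D := by
  obtain ⟨κ, hκ0, hκ1, hκ⟩ := S.exists_branchDeriv_le hε hd
  obtain ⟨C, hC, hhol⟩ := S.exists_log_branchDeriv_holder hε hd
  have hr0 : 0 ≤ κ ^ ε := Real.rpow_nonneg hκ0.le ε
  have hr1 : κ ^ ε < 1 := Real.rpow_lt_one hκ0.le hκ1 hε
  have hpart : ∀ n x, ∀ ξ ∈ UI, ∀ η ∈ UI,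
      |Real.log (S.compDeriv n x ξ) - Real.log (S.compDeriv n x η)|
        ≤ C * ∑ k ∈ Finset.range n, (κ ^ ε) ^ k := by
    intro n x ξ hξ η hη
    induction n generalizing x with
    | zero => simp [compDeriv]
    | succ n ih =>
      rw [S.log_compDeriv_succ n x hξ, S.log_compDeriv_succ n x hη, add_sub_add_comm,
        Finset.sum_range_succ, mul_add, add_comm (C * _)]
      refine (abs_add_le _ _).trans (add_le_add ?_ (ih _))
      refine (hhol _ _ (S.comp_mem n _ hξ) _ (S.comp_mem n _ hη)).trans ?_
      rw [Real.rpow_pow_comm hκ0.le]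
      gcongr
      exact S.abs_comp_sub_le hκ0.le hκ n _ hξ hη
  refine ⟨C * (1 - κ ^ ε)⁻¹, mul_nonneg hC (inv_nonneg.2 (by linarith)),
    fun n x ξ hξ η hη => (hpart n x ξ hξ η hη).trans ?_⟩
  gcongr
  rw [← tsum_geometric_of_lt_one hr0 hr1]
  exact (summable_geometric_of_lt_one hr0 hr1).sum_le_tsum _ fun k _ => pow_nonneg hr0 k

theorem approx_eq_comp (S : ExpMap d ε) (x : ℕ → Fin d) (n : ℕ) :
    approx S x n = S.comp n x 0 := by
  induction n generalizing x with
  | zero => rfl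
  | succ n ih =>
    simp only [approx, comp, ← ih, List.range_succ_eq_map, List.foldr_cons, List.foldr_map]
    rfl

theorem comp_zero_le_comp_succ_zero (S : ExpMap d ε) (x : ℕ → Fin d) (n : ℕ) :
    S.comp n x 0 ≤ S.comp (n + 1) x 0 := by
  induction n generalizing x with
  | zero => exact (S.comp_mem 1 x zero_mem_UI).1
  | succ n ih =>
    exact (S.branch_mono _).monotoneOn (S.comp_mem n _ zero_mem_UI)
      (S.comp_mem (n + 1) _ zero_mem_UI) (ih _)

theorem tendsto_comp_proj (S : ExpMap d ε) (x : ℕ → Fin d) :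
    Tendsto (fun n => S.comp n x 0) atTop (𝓝 (proj S x)) := by
  simp only [proj, S.approx_eq_comp]
  exact tendsto_atTop_ciSup (monotone_nat_of_le_succ (S.comp_zero_le_comp_succ_zero x))
    ⟨1, by rintro _ ⟨n, rfl⟩; exact (S.comp_mem n x zero_mem_UI).2⟩

theorem proj_mem (S : ExpMap d ε) (x : ℕ → Fin d) : proj S x ∈ UI :=
  isClosed_Icc.mem_of_tendsto (S.tendsto_comp_proj x)
    (.of_forall fun n => S.comp_mem n x zero_mem_UI)

theorem proj_eq_branch (S : ExpMap d ε) (x : ℕ → Fin d) :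
    proj S x = S.branch (x 0) (proj S (shift x)) := by
  refine tendsto_nhds_unique ((S.tendsto_comp_proj x).comp (tendsto_add_atTop_nat 1)) ?_
  refine (S.continuousOn_branch (x 0) _ (S.proj_mem _)).tendsto.comp
    (tendsto_nhdsWithin_iff.2 ⟨S.tendsto_comp_proj (shift x), ?_⟩)
  exact .of_forall fun n => S.comp_mem n _ zero_mem_UI

theorem comp_proj (S : ExpMap d ε) (n : ℕ) (x : ℕ → Fin d) :
    S.comp n x (proj S (shift^[n] x)) = proj S x := by
  induction n generalizing x with
  | zero => rfl
  | succ n ih =>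
    rw [S.proj_eq_branch x, ← ih (shift x)]
    rfl

theorem log_compDeriv_proj_succ (S : ExpMap d ε) (n : ℕ) (x : ℕ → Fin d) :
    Real.log (S.compDeriv (n + 1) x (proj S (shift^[n + 1] x))) =
      pot S x + Real.log (S.compDeriv n (shift x) (proj S (shift^[n] (shift x)))) := by
  rw [S.log_compDeriv_succ n x (S.proj_mem _), Function.iterate_succ_apply, S.comp_proj]
  rfl

theorem log_compDeriv_proj_sub {S T : ExpMap d ε} {v : (ℕ → Fin d) → ℝ}
    (hcob : ∀ x, pot T x - pot S x = v x - v (shift x)) (n : ℕ) (x : ℕ → Fin d) :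
    Real.log (T.compDeriv n x (proj T (shift^[n] x))) -
      Real.log (S.compDeriv n x (proj S (shift^[n] x))) = v x - v (shift^[n] x) := by
  induction n generalizing x with
  | zero => simp [compDeriv]
  | succ n ih =>
    rw [log_compDeriv_proj_succ, log_compDeriv_proj_succ, Function.iterate_succ_apply]
    linarith [ih (shift x), hcob x]

/-- Corresponding cylinders of cohomologous systems have comparable lengths. -/
theorem exists_log_length_sub_le {S T : ExpMap d ε} (hε : 0 < ε) (hd : 0 < d)
    {v : (ℕ → Fin d) → ℝ} (hv : ∃ B : ℝ, ∀ x, |v x| ≤ B)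
    (hcob : ∀ x, pot T x - pot S x = v x - v (shift x)) :
    ∃ K : ℝ, 0 ≤ K ∧ ∀ n x, |Real.log (T.comp n x 1 - T.comp n x 0) -
      Real.log (S.comp n x 1 - S.comp n x 0)| ≤ K := by
  obtain ⟨B, hB⟩ := hv
  obtain ⟨D, hD, hSd⟩ := S.exists_distortion_bound hε hd
  obtain ⟨E, hE, hTd⟩ := T.exists_distortion_bound hε hd
  have hB0 : 0 ≤ B := (abs_nonneg _).trans (hB fun _ => ⟨0, hd⟩)
  refine ⟨2 * B + D + E, by positivity, fun n x => ?_⟩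
  obtain ⟨ζ, hζ, hS⟩ := S.exists_compDeriv_eq n x
  obtain ⟨θ, hθ, hT⟩ := T.exists_compDeriv_eq n x
  rw [← hS, ← hT]
  have h1 := abs_le.1 (hSd n x ζ hζ _ (S.proj_mem (shift^[n] x)))
  have h2 := abs_le.1 (hTd n x θ hθ _ (T.proj_mem (shift^[n] x)))
  have h3 := log_compDeriv_proj_sub hcob n x
  have h4 := abs_le.1 (hB x)
  have h5 := abs_le.1 (hB (shift^[n] x))
  rw [abs_le]
  constructor <;> linarith [h1.1, h1.2, h2.1, h2.2, h4.1, h4.2, h5.1, h5.2]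

theorem branch_zero_lt_branch_one (S : ExpMap d ε) (a : Fin d) : S.branch a 0 < S.branch a 1 :=
  S.branch_mono a zero_mem_UI one_mem_UI zero_lt_one

theorem branch_zero_strictMono (S : ExpMap d ε) : StrictMono fun a => S.branch a 0 :=
  fun a b h => (S.branch_zero_lt_branch_one a).trans_le (S.ordered a b h 1 one_mem_UI 0 zero_mem_UI)

theorem branch_one_eq_branch_succ_zero (S : ExpMap d ε) (a : Fin d) (h : (a : ℕ) + 1 < d) :
    S.branch a 1 = S.branch ⟨a + 1, h⟩ 0 := by
  set b : Fin d := ⟨a + 1, h⟩ with hb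
  have hab : a < b := Fin.lt_def.2 (Nat.lt_succ_self _)
  refine le_antisymm (S.ordered a b hab 1 one_mem_UI 0 zero_mem_UI) ?_
  by_contra! hlt
  obtain ⟨p, hp1, hp2⟩ := exists_between hlt
  have hp : p ∈ UI := ⟨((S.branch_maps_to a one_mem_UI).1.trans_lt hp1).le,
    (hp2.trans_le (S.branch_maps_to b zero_mem_UI).2).le⟩
  obtain ⟨c, ξ, hξ, rfl⟩ := mem_iUnion.1 (S.cover hp)
  rcases lt_trichotomy c a with hc | rfl | hc
  · exact (S.ordered c a hc ξ hξ 1 one_mem_UI).not_gt hp1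
  · exact ((S.branch_mono c).monotoneOn hξ one_mem_UI hξ.2).not_gt hp1
  · have hbc : b ≤ c := Fin.le_def.2 (Nat.succ_le_of_lt (Fin.lt_def.1 hc))
    rcases hbc.eq_or_lt with rfl | hbc
    · exact ((S.branch_mono _).monotoneOn zero_mem_UI hξ hξ.1).not_gt hp2
    · exact (S.ordered b c hbc 0 zero_mem_UI ξ hξ).not_gt hp2

theorem branch_last_one (S : ExpMap d ε) (a : Fin d) (h : ¬ (a : ℕ) + 1 < d) :
    S.branch a 1 = 1 := by
  refine le_antisymm (S.branch_maps_to a one_mem_UI).2 ?_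
  obtain ⟨c, ξ, hξ, hc⟩ := mem_iUnion.1 (S.cover one_mem_UI)
  have hca : c ≤ a := Fin.le_def.2 (by omega)
  conv_lhs => rw [← hc]
  rcases hca.eq_or_lt with rfl | hca
  · exact (S.branch_mono _).monotoneOn hξ one_mem_UI hξ.2
  · exact S.ordered c a hca ξ hξ 1 one_mem_UI

theorem exists_branch_eq_of_lt_one (S : ExpMap d ε) {p : ℝ} (hp : p ∈ Ico (0 : ℝ) 1) :
    ∃ a, ∃ ξ ∈ Ico (0 : ℝ) 1, S.branch a ξ = p := by
  obtain ⟨a, ξ, hξ, rfl⟩ := mem_iUnion.1 (S.cover (Ico_subset_Icc_self hp))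
  rcases hξ.2.lt_or_eq with h | rfl
  · exact ⟨a, ξ, ⟨hξ.1, h⟩, rfl⟩
  · by_cases h : (a : ℕ) + 1 < d
    · exact ⟨⟨a + 1, h⟩, 0, ⟨le_rfl, zero_lt_one⟩, (S.branch_one_eq_branch_succ_zero a h).symm⟩
    · exact absurd (S.branch_last_one a h) hp.2.ne

theorem toFun_eq_zero_iff (S : ExpMap d ε) {p : ℝ} (hp : p ∈ UI) :
    S.toFun p = 0 ↔ p ∈ range fun a => S.branch a 0 := by
  constructor
  · intro h
    rcases hp.2.lt_or_eq with h1 | rfl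
    · obtain ⟨a, ξ, hξ, rfl⟩ := S.exists_branch_eq_of_lt_one ⟨hp.1, h1⟩
      rw [S.right_inv a ξ hξ] at h
      exact ⟨a, by rw [h]⟩
    · exact absurd (S.map_one.symm.trans h) one_ne_zero
  · rintro ⟨a, rfl⟩
    exact S.right_inv a 0 ⟨le_rfl, zero_lt_one⟩

section Conjugacy

variable {S T : ExpMap d ε} {Θ : ℝ → ℝ}

theorem _root_.IsConjugacy.mem (h : IsConjugacy S T Θ) {ξ : ℝ} (hξ : ξ ∈ UI) : Θ ξ ∈ UI :=
  h.2.2.1 ▸ mem_image_of_mem Θ hξ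

theorem _root_.IsConjugacy.map_zero (h : IsConjugacy S T Θ) : Θ 0 = 0 := by
  obtain ⟨p, hp, h0⟩ := h.2.2.1.symm ▸ zero_mem_UI
  exact le_antisymm (h0 ▸ h.1.monotoneOn zero_mem_UI hp hp.1) (h.mem zero_mem_UI).1

theorem _root_.IsConjugacy.map_one (h : IsConjugacy S T Θ) : Θ 1 = 1 := by
  obtain ⟨p, hp, h1⟩ := h.2.2.1.symm ▸ one_mem_UI
  exact le_antisymm (h.mem one_mem_UI).2 (h1.symm.le.trans (h.1.monotoneOn hp one_mem_UI hp.2))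

theorem _root_.IsConjugacy.map_branch_zero (h : IsConjugacy S T Θ) (a : Fin d) :
    Θ (S.branch a 0) = T.branch a 0 := by
  have hmono : StrictMono fun a => Θ (S.branch a 0) := fun a b hab =>
    h.1 (S.branch_maps_to a zero_mem_UI) (S.branch_maps_to b zero_mem_UI)
      (S.branch_zero_strictMono hab)
  have hzero : ∀ p ∈ UI, (T.toFun (Θ p) = 0 ↔ S.toFun p = 0) := fun p hp => by
    rw [h.2.2.2 p hp]
    constructor
    · exact fun h0 => h.1.injOn (S.maps_to hp) zero_mem_UI (h0.trans h.map_zero.symm)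
    · exact fun h0 => by rw [h0, h.map_zero]
  have hrange : range (fun a => Θ (S.branch a 0)) = range fun a => T.branch a 0 := by
    ext q
    constructor
    · rintro ⟨b, rfl⟩
      have hb := S.branch_maps_to b zero_mem_UI
      exact (T.toFun_eq_zero_iff (h.mem hb)).1
        ((hzero _ hb).2 ((S.toFun_eq_zero_iff hb).2 ⟨b, rfl⟩))
    · rintro ⟨b, rfl⟩
      have hb := T.branch_maps_to b zero_mem_UI
      obtain ⟨p, hp, hpb⟩ := h.2.2.1.symm ▸ hb
      have h0 := (T.toFun_eq_zero_iff hb).2 ⟨b, rfl⟩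
      rw [← hpb] at h0
      obtain ⟨c, rfl⟩ := (S.toFun_eq_zero_iff hp).1 ((hzero p hp).1 h0)
      exact ⟨c, hpb⟩
  exact congrFun ((hmono.range_inj T.branch_zero_strictMono).1 hrange) a

theorem _root_.IsConjugacy.map_branch (h : IsConjugacy S T Θ) (a : Fin d) {ξ : ℝ}
    (hξ : ξ ∈ UI) : Θ (S.branch a ξ) = T.branch a (Θ ξ) := by
  have hIco : EqOn (fun ξ => Θ (S.branch a ξ)) (fun ξ => T.branch a (Θ ξ)) (Ico 0 1) := by
    intro ξ hξ
    have hξ' := Ico_subset_Icc_self hξ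
    have hSξ := S.branch_maps_to a hξ'
    have hlt : S.branch a ξ < S.branch a 1 := S.branch_mono a hξ' one_mem_UI hξ.2
    have hlt1 : Θ (S.branch a ξ) < 1 := by
      rw [← h.map_one]
      exact h.1 hSξ one_mem_UI (hlt.trans_le (S.branch_maps_to a one_mem_UI).2)
    obtain ⟨b, η, hη, hb⟩ := T.exists_branch_eq_of_lt_one ⟨(h.mem hSξ).1, hlt1⟩
    have hη' := Ico_subset_Icc_self hη
    have hηξ : η = Θ ξ := by
      rw [← T.right_inv b η hη, hb, h.2.2.2 _ hSξ, S.right_inv a ξ hξ]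
    rcases lt_trichotomy a b with hab | rfl | hab
    · have h1 : Θ (S.branch a ξ) < Θ (S.branch b 0) :=
        h.1 hSξ (S.branch_maps_to b zero_mem_UI)
          (hlt.trans_le (S.ordered a b hab 1 one_mem_UI 0 zero_mem_UI))
      rw [h.map_branch_zero, ← hb] at h1
      exact absurd h1 ((T.branch_mono b).monotoneOn zero_mem_UI hη' hη.1).not_gt
    · exact hb.symm.trans (congrArg (T.branch a) hηξ)
    · have h1 : Θ (S.branch a 0) ≤ Θ (S.branch a ξ) :=
        h.1.monotoneOn (S.branch_maps_to a zero_mem_UI) hSξ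
          ((S.branch_mono a).monotoneOn zero_mem_UI hξ' hξ.1)
      rw [h.map_branch_zero, ← hb] at h1
      have h2 := T.branch_mono b hη' one_mem_UI hη.2
      exact absurd (h2.trans_le (T.ordered b a hab 1 one_mem_UI 0 zero_mem_UI)) h1.not_gt
  refine hIco.of_subset_closure (t := UI) (h.2.1.comp (S.continuousOn_branch a)
    (S.branch_maps_to a)) ((T.continuousOn_branch a).comp h.2.1 fun _ => h.mem)
    Ico_subset_Icc_self ?_ hξ
  rw [closure_Ico zero_ne_one]

theorem _root_.IsConjugacy.map_comp (h : IsConjugacy S T Θ) (n : ℕ) (x : ℕ → Fin d) {ξ : ℝ}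
    (hξ : ξ ∈ UI) : Θ (S.comp n x ξ) = T.comp n x (Θ ξ) := by
  induction n generalizing x with
  | zero => rfl
  | succ n ih =>
    simp only [comp]
    rw [h.map_branch _ (S.comp_mem n _ hξ), ih]

end Conjugacy

theorem branch_first_zero (S : ExpMap d ε) (hd : 0 < d) : S.branch ⟨0, hd⟩ 0 = 0 := by
  refine le_antisymm ?_ (S.branch_maps_to _ zero_mem_UI).1
  obtain ⟨c, ξ, hξ, hc⟩ := mem_iUnion.1 (S.cover zero_mem_UI)
  have hc0 : (⟨0, hd⟩ : Fin d) ≤ c := Fin.le_def.2 (Nat.zero_le _)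
  conv_rhs => rw [← hc]
  rcases hc0.eq_or_lt with rfl | hc0
  · exact (S.branch_mono _).monotoneOn zero_mem_UI hξ hξ.1
  · exact S.ordered _ c hc0 0 zero_mem_UI ξ hξ

/-- The endpoints of the cylinder intervals of level `n`. -/
def endpoints (S : ExpMap d ε) : ℕ → Set ℝ
  | 0 => {0, 1}
  | n + 1 => ⋃ a, S.branch a '' endpoints S n

theorem zero_mem_endpoints (S : ExpMap d ε) (hd : 0 < d) (n : ℕ) : 0 ∈ S.endpoints n := by
  induction n with
  | zero => exact mem_insert 0 _
  | succ n ih => exact mem_iUnion.2 ⟨⟨0, hd⟩, 0, ih, S.branch_first_zero hd⟩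

theorem one_mem_endpoints (S : ExpMap d ε) (hd : 0 < d) (n : ℕ) : 1 ∈ S.endpoints n := by
  induction n with
  | zero => exact mem_insert_of_mem 0 rfl
  | succ n ih =>
    exact mem_iUnion.2 ⟨⟨d - 1, Nat.sub_lt hd one_pos⟩, 1, ih,
      S.branch_last_one _ (by simp only; omega)⟩

theorem endpoints_subset (S : ExpMap d ε) (n : ℕ) : S.endpoints n ⊆ UI := by
  induction n with
  | zero => exact insert_subset zero_mem_UI (singleton_subset_iff.2 one_mem_UI)
  | succ n ih =>
    exact iUnion_subset fun a => ((S.branch_maps_to a).mono_left ih).image_subset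

theorem comp_mem_endpoints (S : ExpMap d ε) (n : ℕ) (x : ℕ → Fin d) {e : ℝ}
    (he : e ∈ S.endpoints 0) : S.comp n x e ∈ S.endpoints n := by
  induction n generalizing x with
  | zero => exact he
  | succ n ih => exact mem_iUnion.2 ⟨x 0, _, ih (shift x), rfl⟩

/-- Prepending a letter to a sequence. -/
def prepend (a : Fin d) (x : ℕ → Fin d) : ℕ → Fin d
  | 0 => a
  | n + 1 => x n

theorem exists_comp_eq (S : ExpMap d ε) (hd : 0 < d) (n : ℕ) {p : ℝ} (hp : p ∈ UI) :
    ∃ x, ∃ ξ ∈ UI, S.comp n x ξ = p := by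
  induction n generalizing p with
  | zero => exact ⟨fun _ => ⟨0, hd⟩, p, hp, rfl⟩
  | succ n ih =>
    obtain ⟨a, q, hq, rfl⟩ := mem_iUnion.1 (S.cover hp)
    obtain ⟨x, ξ, hξ, rfl⟩ := ih hq
    exact ⟨prepend a x, ξ, hξ, rfl⟩

/-- If `F` increases across each first level interval, then it increases along the gaps between
them. -/
theorem apply_branch_one_le (S : ExpMap d ε) {F : ℝ → ℝ}
    (hF : ∀ a, F (S.branch a 0) ≤ F (S.branch a 1)) {a b : Fin d} (hab : a < b) :
    F (S.branch a 1) ≤ F (S.branch b 0) := by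
  obtain ⟨k, hk⟩ := Nat.exists_eq_add_of_lt (Fin.lt_def.1 hab)
  induction k generalizing a with
  | zero =>
    rw [S.branch_one_eq_branch_succ_zero a (by omega),
      show (⟨a + 1, by omega⟩ : Fin d) = b from Fin.ext (by simp only; omega)]
  | succ k ih =>
    rw [S.branch_one_eq_branch_succ_zero a (by omega)]
    exact (hF _).trans (ih (Fin.lt_def.2 (by simp only; omega)) (by simp only; omega))

/-- A function that increases across each cylinder interval of level `n` is monotone on the
endpoints of these intervals. -/
theorem monotoneOn_endpoints (S : ExpMap d ε) (hd : 0 < d) (n : ℕ) {F : ℝ → ℝ}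
    (hF : ∀ x, F (S.comp n x 0) ≤ F (S.comp n x 1)) : MonotoneOn F (S.endpoints n) := by
  induction n generalizing F with
  | zero =>
    have h := hF fun _ => ⟨0, hd⟩
    rintro p (rfl | rfl) q (rfl | rfl) hpq
    exacts [le_rfl, h, absurd hpq (by norm_num), le_rfl]
  | succ n ih =>
    have hmono : ∀ a, MonotoneOn (fun ξ => F (S.branch a ξ)) (S.endpoints n) :=
      fun a => ih fun x => hF (prepend a x)
    have h0 := S.zero_mem_endpoints hd n
    have h1 := S.one_mem_endpoints hd n
    intro p hp q hq hpq
    obtain ⟨a, u, hu, rfl⟩ := mem_iUnion.1 hp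
    obtain ⟨b, w, hw, rfl⟩ := mem_iUnion.1 hq
    have hu' := S.endpoints_subset n hu
    have hw' := S.endpoints_subset n hw
    rcases lt_trichotomy a b with hab | rfl | hab
    · calc F (S.branch a u) ≤ F (S.branch a 1) := hmono a hu h1 hu'.2
        _ ≤ F (S.branch b 0) := S.apply_branch_one_le (fun c => hmono c h0 h1 zero_le_one) hab
        _ ≤ F (S.branch b w) := hmono b h0 hw hw'.1
    · exact hmono a hu hw (((S.branch_mono a).le_iff_le hu' hw').1 hpq)
    · exact (congrArg F (hpq.antisymm (S.ordered b a hab w hw' u hu'))).le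

/-- A continuous function that increases across every cylinder interval is monotone. -/
theorem monotoneOn_of_comp (S : ExpMap d ε) (hε : 0 < ε) (hd : 0 < d) {F : ℝ → ℝ}
    (hc : ContinuousOn F UI) (hF : ∀ n x, F (S.comp n x 0) ≤ F (S.comp n x 1)) :
    MonotoneOn F UI := by
  obtain ⟨κ, hκ0, hκ1, hκ⟩ := S.exists_branchDeriv_le hε hd
  have hlim : ∀ p ∈ UI, ∀ u : ℕ → ℝ, (∀ n, u n ∈ UI) → (∀ n, |u n - p| ≤ κ ^ n) →
      Tendsto (fun n => F (u n)) atTop (𝓝 (F p)) := by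
    intro p hp u hu hup
    refine (hc p hp).tendsto.comp (tendsto_nhdsWithin_iff.2 ⟨?_, .of_forall hu⟩)
    exact tendsto_iff_dist_tendsto_zero.2 (squeeze_zero (fun _ => dist_nonneg) hup
      (tendsto_pow_atTop_nhds_zero_of_lt_one hκ0.le hκ1))
  intro p hp q hq hpq
  choose x ξ hξ hx using fun n => S.exists_comp_eq hd n hp
  choose y η hη hy using fun n => S.exists_comp_eq hd n hq
  refine le_of_tendsto_of_tendsto'
    (hlim p hp (fun n => S.comp n (x n) 0) (fun n => S.comp_mem n _ zero_mem_UI) fun n => ?_)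
    (hlim q hq (fun n => S.comp n (y n) 1) (fun n => S.comp_mem n _ one_mem_UI) fun n => ?_)
    fun n => S.monotoneOn_endpoints hd n (hF n)
      (S.comp_mem_endpoints n _ (S.zero_mem_endpoints hd 0))
      (S.comp_mem_endpoints n _ (S.one_mem_endpoints hd 0)) ?_
  · rw [← hx n]
    exact S.abs_comp_sub_le hκ0.le hκ n _ zero_mem_UI (hξ n)
  · rw [← hy n]
    exact S.abs_comp_sub_le hκ0.le hκ n _ one_mem_UI (hη n)
  · calc S.comp n (x n) 0 ≤ p := by
          conv_rhs => rw [← hx n]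
          exact (S.comp_strictMonoOn n _).monotoneOn zero_mem_UI (hξ n) (hξ n).1
      _ ≤ q := hpq
      _ ≤ S.comp n (y n) 1 := by
          conv_lhs => rw [← hy n]
          exact (S.comp_strictMonoOn n _).monotoneOn (hη n) one_mem_UI (hη n).2

end ExpMap

/-- If `χ = v - v∘σ` for some bounded `v : Σ → ℝ`, then the conjugacy
`Θ` is bi-Lipschitz: there is `c ≥ 1` with `c⁻¹|ξ-η| ≤ |Θ(ξ)-Θ(η)| ≤ c|ξ-η|` on `𝒰`. -/
theorem statement_11 {d : ℕ} {ε : ℝ} (hd : 2 ≤ d) (hε : 0 < ε)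
    (S T : ExpMap d ε) (Θ : ℝ → ℝ) (hΘ : IsConjugacy S T Θ)
    (v : (ℕ → Fin d) → ℝ) (hv : ∃ B : ℝ, ∀ x, |v x| ≤ B)
    (hcob : ∀ x : ℕ → Fin d, pot T x - pot S x = v x - v (shift x)) :
    ∃ c : ℝ, 1 ≤ c ∧ ∀ ξ ∈ UI, ∀ η ∈ UI,
      c⁻¹ * |ξ - η| ≤ |Θ ξ - Θ η| ∧ |Θ ξ - Θ η| ≤ c * |ξ - η| := by
  have hd0 : 0 < d := by omega
  obtain ⟨K, hK, hlen⟩ := ExpMap.exists_log_length_sub_le hε hd0 hv hcob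
  have hcyl : ∀ n x, Θ (S.comp n x 1) - Θ (S.comp n x 0)
        ≤ Real.exp K * (S.comp n x 1 - S.comp n x 0) ∧
      S.comp n x 1 - S.comp n x 0
        ≤ Real.exp K * (Θ (S.comp n x 1) - Θ (S.comp n x 0)) := by
    intro n x
    rw [hΘ.map_comp n x ExpMap.one_mem_UI, hΘ.map_comp n x ExpMap.zero_mem_UI, hΘ.map_zero,
      hΘ.map_one]
    have hS := sub_pos.2
      (S.comp_strictMonoOn n x ExpMap.zero_mem_UI ExpMap.one_mem_UI zero_lt_one)
    have hT := sub_pos.2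
      (T.comp_strictMonoOn n x ExpMap.zero_mem_UI ExpMap.one_mem_UI zero_lt_one)
    obtain ⟨h1, h2⟩ := abs_sub_le_iff.1 (hlen n x)
    constructor
    · rw [← Real.log_le_log_iff hT (by positivity), Real.log_mul (Real.exp_pos K).ne' hS.ne',
        Real.log_exp]
      linarith
    · rw [← Real.log_le_log_iff hS (by positivity), Real.log_mul (Real.exp_pos K).ne' hT.ne',
        Real.log_exp]
      linarith
  have hupper : MonotoneOn (fun ξ => Real.exp K * ξ - Θ ξ) UI :=
    S.monotoneOn_of_comp hε hd0 ((continuousOn_const.mul continuousOn_id).sub hΘ.2.1)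
      fun n x => by linarith [(hcyl n x).1]
  have hlower : MonotoneOn (fun ξ => Real.exp K * Θ ξ - ξ) UI :=
    S.monotoneOn_of_comp hε hd0 ((continuousOn_const.mul hΘ.2.1).sub continuousOn_id)
      fun n x => by linarith [(hcyl n x).2]
  have hmain : ∀ ξ ∈ UI, ∀ η ∈ UI, ξ ≤ η →
      (Real.exp K)⁻¹ * |ξ - η| ≤ |Θ ξ - Θ η| ∧ |Θ ξ - Θ η| ≤ Real.exp K * |ξ - η| := by
    intro ξ hξ η hη h
    have hΘle := hΘ.1.monotoneOn hξ hη h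
    rw [abs_sub_comm ξ, abs_sub_comm (Θ ξ), abs_of_nonneg (sub_nonneg.2 h),
      abs_of_nonneg (sub_nonneg.2 hΘle), inv_mul_le_iff₀ (Real.exp_pos K)]
    have h1 := hupper hξ hη h
    have h2 := hlower hξ hη h
    simp only at h1 h2
    constructor <;> linarith
  refine ⟨Real.exp K, Real.one_le_exp hK, fun ξ hξ η hη => ?_⟩
  rcases le_total ξ η with h | h
  · exact hmain ξ hξ η hη h
  · rw [abs_sub_comm ξ, abs_sub_comm (Θ ξ)]
    exact hmain η hη ξ hξ h
end
end
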